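/- Let f(x,y) = M(x,y) + b be a pseudo-monomial automorphism of (K^×)^2 (written additively) whose monomial part M ∈ GL_2(Z) is loxodromic. Then Id - M is invertible over Q, and f has a fixed point in (\bar{K}^×)^2 after passing to a finite extension; moreover, over K, if for every absolute value v on K the vector (Id - M)^{-1}(log|b|_v) decomposes with zero coefficients on both eigenvectors shifted by u_0, i.e., the logarithmic orbit sequence is bounded for all v, then ||f^n(p)||_v = ||p||_v for all n and all v. -/

import Mathlib

/-- The monomial action of an integer matrix on pairs of elements of a commutative group. -/
def monoAct {G : Type*} [CommGroup G] (A : Matrix (Fin 2) (Fin 2) ℤ) (g : G × G) : G × G :=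
  (g.1 ^ A 0 0 * g.2 ^ A 0 1, g.1 ^ A 1 0 * g.2 ^ A 1 1)

theorem monoAct_mul {G : Type*} [CommGroup G] (A B : Matrix (Fin 2) (Fin 2) ℤ) (g : G × G) :
    monoAct (A * B) g = monoAct A (monoAct B g) := by
  ext <;> simp only [monoAct, Matrix.mul_apply, Fin.sum_univ_two, mul_zpow, ← zpow_mul,
    zpow_add, mul_comm (B _ _)] <;> simp only [mul_assoc, mul_left_comm, mul_comm]

theorem monoAct_one {G : Type*} [CommGroup G] (g : G × G) :
    monoAct (1 : Matrix (Fin 2) (Fin 2) ℤ) g = g := by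
  ext <;> simp [monoAct]

theorem monoAct_map_mul {G : Type*} [CommGroup G] (A : Matrix (Fin 2) (Fin 2) ℤ) (g h : G × G) :
    monoAct A (g * h) = monoAct A g * monoAct A h := by
  ext <;> simp only [monoAct, Prod.fst_mul, Prod.snd_mul, mul_zpow] <;>
    simp only [mul_assoc, mul_left_comm]

theorem monoAct_map {G H : Type*} [CommGroup G] [CommGroup H] (φ : G →* H)
    (A : Matrix (Fin 2) (Fin 2) ℤ) (g : G × G) :
    monoAct A (φ g.1, φ g.2) = (φ (monoAct A g).1, φ (monoAct A g).2) := by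
  ext <;> simp [monoAct]

theorem monoAct_scalar {G : Type*} [CommGroup G] (d : ℤ) (g : G × G) :
    monoAct (d • (1 : Matrix (Fin 2) (Fin 2) ℤ)) g = (g.1 ^ d, g.2 ^ d) := by
  ext <;> simp [monoAct]

theorem lox_trace_rec (M : Matrix (Fin 2) (Fin 2) ℤ) (k : ℕ) :
    (M ^ (k + 2)).trace = M.trace * (M ^ (k + 1)).trace - M.det * (M ^ k).trace := by
  have h : M ^ (k + 2) = M.trace • M ^ (k + 1) - M.det • M ^ k := by
    have h2 : M ^ 2 = M.trace • M - M.det • (1 : Matrix (Fin 2) (Fin 2) ℤ) := by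
      rw [pow_two]
      ext i j
      fin_cases i <;> fin_cases j <;>
        simp [-zsmul_eq_mul, -zsmul_one, Matrix.mul_apply, Fin.sum_univ_two, Matrix.trace,
          Matrix.det_fin_two] <;> ring
    rw [pow_add, h2, mul_sub, mul_smul_comm, mul_smul_comm, mul_one, pow_succ]
  rw [h]
  simp [-zsmul_eq_mul, Matrix.trace_sub, Matrix.trace_smul]

theorem lox_trace_pow (M : Matrix (Fin 2) (Fin 2) ℤ) (hdet : M.det = 1 ∨ M.det = -1)
    (htr : 2 < |M.trace|) (k : ℕ) :
    2 ≤ |(M ^ k).trace| ∧ |(M ^ k).trace| < |(M ^ (k + 1)).trace| := by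
  induction k with
  | zero => simpa using htr
  | succ k ih =>
    refine ⟨by linarith [ih.1, ih.2], ?_⟩
    rw [lox_trace_rec]
    have h1 : |M.trace * (M ^ (k + 1)).trace| = |M.trace| * |(M ^ (k + 1)).trace| := abs_mul _ _
    have h2 : |M.det * (M ^ k).trace| = |(M ^ k).trace| := by
      rcases hdet with h | h <;> simp [h]
    have h3 := abs_sub_abs_le_abs_sub (M.trace * (M ^ (k + 1)).trace) (M.det * (M ^ k).trace)
    rw [h1, h2] at h3
    nlinarith [ih.1, ih.2]

theorem lox_det_pow_sub_one (M : Matrix (Fin 2) (Fin 2) ℤ) (hdet : M.det = 1 ∨ M.det = -1)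
    (htr : 2 < |M.trace|) (k : ℕ) (hk : 0 < k) : (M ^ k - 1).det ≠ 0 := by
  obtain ⟨j, rfl⟩ : ∃ j, k = j + 1 := ⟨k - 1, by omega⟩
  have h := lox_trace_pow M hdet htr j
  have hd : (M ^ (j + 1)).det = 1 ∨ (M ^ (j + 1)).det = -1 := by
    rw [Matrix.det_pow]
    rcases hdet with h | h <;> rw [h]
    · simp
    · exact neg_one_pow_eq_or ℤ _
  have e : (M ^ (j + 1) - 1).det = (M ^ (j + 1)).det - (M ^ (j + 1)).trace + 1 := by
    generalize M ^ (j + 1) = A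
    simp [Matrix.det_fin_two, Matrix.trace, Fin.sum_univ_two]; ring
  rw [e]
  intro h0
  have : (M ^ (j + 1)).trace = (M ^ (j + 1)).det + 1 := by linarith
  rw [this] at h
  rcases hd with hd | hd <;> rw [hd] at h <;> norm_num at h <;> linarith [h.1, h.2]

/-- An orbit with a repetition consists of torsion elements. -/
theorem lox_torsion {G : Type*} [CommGroup G] (M : Matrix (Fin 2) (Fin 2) ℤ)
    (hdet : M.det = 1 ∨ M.det = -1) (htr : 2 < |M.trace|) (g : G × G)
    (m n : ℕ) (hmn : m < n) (h : monoAct (M ^ m) g = monoAct (M ^ n) g) :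
    ∃ d : ℤ, d ≠ 0 ∧ g.1 ^ d = 1 ∧ g.2 ^ d = 1 := by
  obtain ⟨k, rfl⟩ : ∃ k, n = m + k := ⟨n - m, by omega⟩
  have hk : 0 < k := by omega
  have hMu : IsUnit M.det := by rcases hdet with h | h <;> rw [h] <;> simp
  have hcancel : monoAct (M ^ k) g = g := by
    have h1 : (M⁻¹) ^ m * M ^ m = 1 := by
      have hc : Commute M⁻¹ M := by
        rw [Commute, SemiconjBy, Matrix.nonsing_inv_mul _ hMu, Matrix.mul_nonsing_inv _ hMu]
      rw [← hc.mul_pow, Matrix.nonsing_inv_mul _ hMu, one_pow]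
    rw [pow_add, monoAct_mul] at h
    have h2 := congrArg (monoAct ((M⁻¹) ^ m)) h
    rw [← monoAct_mul, ← monoAct_mul, h1, monoAct_one, monoAct_one] at h2
    exact h2.symm
  have hsub : monoAct (M ^ k - 1) g = 1 := by
    have : monoAct (M ^ k - 1) g * monoAct 1 g = monoAct (M ^ k) g := by
      ext <;> simp only [monoAct, Matrix.sub_apply, Prod.fst_mul, Prod.snd_mul] <;>
        rw [mul_mul_mul_comm, ← zpow_add, ← zpow_add, sub_add_cancel, sub_add_cancel]
    rw [monoAct_one, hcancel] at this
    simpa using this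
  refine ⟨(M ^ k - 1).det, lox_det_pow_sub_one M hdet htr k hk, ?_⟩
  have h3 := congrArg (monoAct (M ^ k - 1).adjugate) hsub
  rw [← monoAct_mul, Matrix.adjugate_mul, monoAct_scalar] at h3
  have h4 : monoAct (M ^ k - 1).adjugate (1 : G × G) = 1 := by ext <;> simp [monoAct]
  rw [h4] at h3
  exact ⟨congrArg Prod.fst h3, congrArg Prod.snd h3⟩

/-- Bounded rational orbits are trivial. -/
theorem lox_rational_bounded (M : Matrix (Fin 2) (Fin 2) ℤ)
    (hdet : M.det = 1 ∨ M.det = -1) (htr : 2 < |M.trace|) (u1 u2 : ℝ) (a b : ℤ)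
    (hab : a ≠ 0 ∨ b ≠ 0) (hrel : a * u1 + b * u2 = 0)
    (hbd : ∃ C : ℝ, ∀ n : ℕ, |(M ^ n) 0 0 * u1 + (M ^ n) 0 1 * u2| ≤ C ∧
      |(M ^ n) 1 0 * u1 + (M ^ n) 1 1 * u2| ≤ C) : u1 = 0 ∧ u2 = 0 := by
  obtain ⟨C, hC⟩ := hbd
  obtain ⟨t, h1, h2⟩ : ∃ t : ℝ, u1 = t * b ∧ u2 = t * (-a : ℤ) := by
    by_cases ha : a = 0
    · have hb : b ≠ 0 := by tauto
      have hb' : (b : ℝ) ≠ 0 := by exact_mod_cast hb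
      refine ⟨u1 / b, by field_simp, ?_⟩
      simp [ha] at hrel ⊢; tauto
    · have ha' : (a : ℝ) ≠ 0 := by exact_mod_cast ha
      refine ⟨-u2 / a, ?_, by push_cast; field_simp⟩
      field_simp; linarith
  by_cases ht : t = 0
  · simp [h1, h2, ht]
  exfalso
  let w : Multiplicative ℤ × Multiplicative ℤ := (Multiplicative.ofAdd b, Multiplicative.ofAdd (-a))
  let N : ℤ := ⌈C / |t|⌉
  have htp : 0 < |t| := abs_pos.mpr ht
  have key : ∀ z : ℤ, |t * z| ≤ C → z ∈ Set.Icc (-N) N := by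
    intro z hz
    rw [abs_mul, ← le_div_iff₀' htp] at hz
    have : |z| ≤ N := by
      have h := hz.trans (Int.le_ceil (C / |t|))
      exact_mod_cast h
    exact abs_le.mp this
  have hfin : (Set.range fun n : ℕ => monoAct (M ^ n) w).Finite := by
    have hf : ((Set.Icc (-N) N) ×ˢ (Set.Icc (-N) N) : Set (ℤ × ℤ)).Finite :=
      (Set.finite_Icc _ _).prod (Set.finite_Icc _ _)
    refine (hf.image fun z => (Multiplicative.ofAdd z.1, Multiplicative.ofAdd z.2)).subset ?_
    rintro _ ⟨n, rfl⟩
    refine ⟨((M ^ n) 0 0 * b + (M ^ n) 0 1 * (-a), (M ^ n) 1 0 * b + (M ^ n) 1 1 * (-a)),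
      ⟨key _ ?_, key _ ?_⟩, ?_⟩
    · convert (hC n).1 using 2; rw [h1, h2]; push_cast; ring
    · convert (hC n).2 using 2; rw [h1, h2]; push_cast; ring
    · simp only [monoAct, w, ofAdd_add, ← ofAdd_zsmul, smul_eq_mul]
  have hni : ¬ Function.Injective fun n : ℕ => monoAct (M ^ n) w := fun hi =>
    Set.infinite_range_of_injective hi hfin
  simp only [Function.Injective, not_forall] at hni
  obtain ⟨m, n, hmn, hne⟩ := hni
  obtain ⟨d, hd, hd1, hd2⟩ : ∃ d : ℤ, d ≠ 0 ∧ w.1 ^ d = 1 ∧ w.2 ^ d = 1 := by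
    rcases lt_or_gt_of_ne hne with h | h
    · exact lox_torsion M hdet htr w m n h hmn
    · exact lox_torsion M hdet htr w n m h hmn.symm
  simp only [w, ← ofAdd_zsmul, smul_eq_mul, ofAdd_eq_one] at hd1 hd2
  simp [hd] at hd1 hd2
  tauto


theorem nonarch_of_nat_le_one {K : Type*} [Field K] (v : AbsoluteValue K ℝ)
    (h : ∀ n : ℕ, v (n : K) ≤ 1) : IsNonarchimedean v := by
  have : IsUltrametricDist (WithAbs v) := by
    apply IsUltrametricDist.isUltrametricDist_of_forall_norm_natCast_le_one
    intro n
    exact h n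
  intro x y
  exact IsUltrametricDist.isNonarchimedean_norm (R := WithAbs v) (WithAbs.toAbs v x) (WithAbs.toAbs v y)

theorem nonarch_algebraic_value {A L : Type*} [Field A] [Field L] [Algebra A L]
    (v : AbsoluteValue L ℝ) (hv : IsNonarchimedean v) (z : L) (hz : z ≠ 0)
    (halg : IsAlgebraic A z) :
    ∃ k : ℤ, k ≠ 0 ∧ ∃ a : A, a ≠ 0 ∧ k * Real.log (v z) = Real.log (v (algebraMap A L a)) := by
  classical
  obtain ⟨P, hP0, hP⟩ := halg
  rw [Polynomial.aeval_eq_sum_range] at hP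
  set s := (Finset.range (P.natDegree + 1)).filter (fun i => P.coeff i ≠ 0) with hs
  have hsum : ∑ i ∈ s, P.coeff i • z ^ i = 0 := by
    rw [← hP, hs, Finset.sum_filter]
    refine Finset.sum_congr rfl fun i _ => ?_
    by_cases h : P.coeff i = 0 <;> simp [h]
  have hne : s.Nonempty := by
    refine ⟨P.natDegree, ?_⟩
    simp [hs, hP0]
  have hnz : ∀ i ∈ s, P.coeff i • z ^ i ≠ 0 := by
    intro i hi
    simp only [hs, Finset.mem_filter] at hi
    exact smul_ne_zero hi.2 (pow_ne_zero _ hz)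
  obtain ⟨i, hi, hmax⟩ := s.exists_max_image (fun i => v (P.coeff i • z ^ i)) hne
  obtain ⟨j, hj, hji, heq⟩ : ∃ j ∈ s, j ≠ i ∧ v (P.coeff j • z ^ j) = v (P.coeff i • z ^ i) := by
    by_contra! hcon
    have := hv.apply_sum_eq_of_lt (f := v) (s := s) (l := fun i => P.coeff i • z ^ i) (k := i)
      (by intro a; exact (v.map_neg a).symm) hi
      (fun j hj hji => lt_of_le_of_ne (hmax j hj) (hcon j hj hji))
    rw [hsum, map_zero] at this
    exact hnz i hi (v.eq_zero.mp this.symm)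
  have hci : P.coeff i ≠ 0 := (Finset.mem_filter.mp hi).2
  have hcj : P.coeff j ≠ 0 := (Finset.mem_filter.mp hj).2
  have hci' : v (algebraMap A L (P.coeff i)) ≠ 0 := by simpa using hci
  have hcj' : v (algebraMap A L (P.coeff j)) ≠ 0 := by simpa using hcj
  have hvz : v z ≠ 0 := by simpa using hz
  refine ⟨(i : ℤ) - j, by omega, P.coeff j / P.coeff i, div_ne_zero hcj hci, ?_⟩
  simp only [Algebra.smul_def, map_mul, map_pow] at heq
  have hl := congrArg Real.log heq
  rw [Real.log_mul hcj' (pow_ne_zero _ hvz), Real.log_mul hci' (pow_ne_zero _ hvz), Real.log_pow,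
    Real.log_pow] at hl
  rw [map_div₀, map_div₀, Real.log_div hcj' hci']
  push_cast
  linarith

theorem nonarch_rational_relation {A L : Type*} [Field A] [Field L] [Algebra A L]
    (v : AbsoluteValue L ℝ) (hv : IsNonarchimedean v) (τ : ℝ)
    (hτ : ∀ a : A, a ≠ 0 → ∃ m : ℤ, Real.log (v (algebraMap A L a)) = m * τ)
    (x y : L) (hx : x ≠ 0) (hy : y ≠ 0) (hxa : IsAlgebraic A x) (hya : IsAlgebraic A y) :
    ∃ a b : ℤ, (a ≠ 0 ∨ b ≠ 0) ∧ a * Real.log (v x) + b * Real.log (v y) = 0 := by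
  obtain ⟨k, hk, c, hc, h1⟩ := nonarch_algebraic_value v hv x hx hxa
  obtain ⟨l, hl, d, hd, h2⟩ := nonarch_algebraic_value v hv y hy hya
  obtain ⟨m, hm⟩ := hτ c hc
  obtain ⟨n, hn⟩ := hτ d hd
  rw [hm] at h1
  rw [hn] at h2
  by_cases hm0 : m = 0
  · exact ⟨k, 0, Or.inl hk, by simpa [hm0] using h1⟩
  · refine ⟨k * n, -(l * m), Or.inr (by simp [hl, hm0]), ?_⟩
    push_cast
    linear_combination n * h1 - m * h2

theorem nonarch_rat_values {K : Type*} [Field K] [CharZero K] (v : AbsoluteValue K ℝ)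
    (hv : IsNonarchimedean v) :
    ∃ τ : ℝ, ∀ a : ℚ, a ≠ 0 → ∃ m : ℤ, Real.log (v (algebraMap ℚ K a)) = m * τ := by
  let w : AbsoluteValue ℚ ℝ := v.comp (algebraMap ℚ K).injective
  have hw : ∀ a, w a = v (algebraMap ℚ K a) := fun _ => rfl
  by_cases hnt : w.IsNontrivial
  · have hb : ∀ n : ℕ, w n ≤ 1 := by
      intro n
      rw [hw, map_natCast]
      exact hv.apply_natCast_le_one
    obtain ⟨p, ⟨hp, he⟩, -⟩ := Rat.AbsoluteValue.equiv_padic_of_bounded hnt hb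
    rw [AbsoluteValue.isEquiv_iff_exists_rpow_eq] at he
    obtain ⟨c, hc, he⟩ := he
    refine ⟨-Real.log p / c, fun a ha => ⟨padicValRat p a, ?_⟩⟩
    have h := congrFun he a
    simp only [Rat.AbsoluteValue.padic_eq_padicNorm, padicNorm.eq_zpow_of_nonzero ha] at h
    have hpos : 0 < w a := w.pos ha
    have h' := congrArg Real.log h
    rw [Real.log_rpow hpos] at h'
    push_cast at h'
    rw [Real.log_zpow] at h'
    rw [← hw]
    field_simp
    push_cast at h'
    linarith
  · refine ⟨0, fun a ha => ⟨0, ?_⟩⟩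
    rw [AbsoluteValue.IsNontrivial] at hnt
    push Not at hnt
    rw [← hw, hnt a ha]; simp

theorem charP_algebraic_value {K : Type*} [Field K] (p : ℕ) [Fact p.Prime] [Algebra (ZMod p) K]
    (v : AbsoluteValue K ℝ) (x : K) (hx : x ≠ 0) (h : IsAlgebraic (ZMod p) x) : v x = 1 := by
  have : FiniteDimensional (ZMod p) (IntermediateField.adjoin (ZMod p) {x}) :=
    IntermediateField.adjoin.finiteDimensional h.isIntegral
  have : Finite (IntermediateField.adjoin (ZMod p) {x}) := Module.finite_of_finite (ZMod p)
  have : Fintype (IntermediateField.adjoin (ZMod p) {x}) := Fintype.ofFinite _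
  let y : (IntermediateField.adjoin (ZMod p) {x}) := ⟨x, IntermediateField.mem_adjoin_simple_self _ x⟩
  have hy : y ≠ 0 := fun h => hx (congrArg Subtype.val h)
  have h1 := FiniteField.pow_card_sub_one_eq_one y hy
  have h2 : x ^ (Fintype.card (IntermediateField.adjoin (ZMod p) {x}) - 1) = 1 :=
    congrArg Subtype.val h1
  have h3 := congrArg v h2
  rw [map_pow, map_one] at h3
  have := Fintype.one_lt_card (α := IntermediateField.adjoin (ZMod p) {x})
  exact (pow_eq_one_iff_of_nonneg (v.nonneg x) (by omega)).mp h3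


theorem exists_abs_extension {F K : Type*} [Field F] [Field K] [Algebra F K]
    [Algebra.IsAlgebraic F K] (w : AbsoluteValue F ℝ) (hw : IsNonarchimedean w)
    (x : F) (hx : 1 < w x) :
    ∃ v : AbsoluteValue K ℝ, IsNonarchimedean v ∧ ∀ a, v (algebraMap F K a) = w a := by
  have hum : IsUltrametricDist (WithAbs w) :=
    IsUltrametricDist.isUltrametricDist_of_isNonarchimedean_norm
      (fun a b => hw a.ofAbs b.ofAbs)
  let E := w.Completion
  have hcoe : ∀ a : F, ‖((WithAbs.toAbs w a : WithAbs w) : E)‖ = w a := by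
    intro a
    exact UniformSpace.Completion.norm_coe _
  let : NontriviallyNormedField E :=
    { (inferInstance : NormedField E) with
      non_trivial := ⟨((WithAbs.toAbs w x : WithAbs w) : E), by rw [hcoe]; exact hx⟩ }
  have : IsUltrametricDist E := by
    apply IsUltrametricDist.isUltrametricDist_of_forall_norm_natCast_le_one
    intro n
    have : ((n : ℕ) : E) = ((WithAbs.toAbs w (n : F) : WithAbs w) : E) := by
      have h1 := map_natCast (UniformSpace.Completion.coeRingHom : WithAbs w →+* E) n
      rw [← h1]
      rfl
    rw [this, hcoe]
    exact hw.apply_natCast_le_one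
  let Ω := AlgebraicClosure E
  let ι : F →+* Ω := (algebraMap E Ω).comp
    ((UniformSpace.Completion.coeRingHom : WithAbs w →+* E).comp (WithAbs.equiv w).symm.toRingHom)
  let : Algebra F Ω := ι.toAlgebra
  let j : K →ₐ[F] Ω := IsAlgClosed.lift
  let V : AbsoluteValue Ω ℝ :=
    { toFun := spectralMulAlgNorm E Ω
      map_mul' := map_mul _
      nonneg' := apply_nonneg _
      eq_zero' := fun _ => map_eq_zero_iff_eq_zero _
      add_le' := map_add_le_add _ }
  have hV : ∀ a, V a = spectralNorm E Ω a := fun _ => rfl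
  refine ⟨V.comp (f := (j : K →+* Ω)) (RingHom.injective _), ?_, ?_⟩
  · intro a b
    change V (j (a + b)) ≤ max (V (j a)) (V (j b))
    rw [map_add]
    exact isNonarchimedean_spectralNorm _ _
  · intro a
    change V (j (algebraMap F K a)) = w a
    rw [AlgHom.commutes, hV]
    change spectralNorm E Ω (algebraMap E Ω _) = _
    rw [spectralNorm_extends]
    exact hcoe a

theorem ratFunc_abs (E : Type*) [Field E] : ∃ w : AbsoluteValue (RatFunc E) ℝ,
    IsNonarchimedean w ∧ ∀ r, r ≠ 0 → w r = (2 : ℝ) ^ r.intDegree := by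
  classical
  let g : RatFunc E → ℝ := fun r => if r = 0 then 0 else (2 : ℝ) ^ r.intDegree
  have hg0 : g 0 = 0 := if_pos rfl
  have hg : ∀ r, r ≠ 0 → g r = (2 : ℝ) ^ r.intDegree := fun r hr => if_neg hr
  have hnn : ∀ r, 0 ≤ g r := by
    intro r
    by_cases hr : r = 0
    · rw [hr, hg0]
    · rw [hg r hr]; positivity
  have hna : IsNonarchimedean g := by
    intro x y
    by_cases hx : x = 0
    · rw [hx, zero_add]; exact le_max_right _ _
    by_cases hy : y = 0
    · rw [hy, add_zero]; exact le_max_left _ _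
    by_cases hxy : x + y = 0
    · rw [hxy, hg0]; exact (hnn x).trans (le_max_left _ _)
    rw [hg _ hx, hg _ hy, hg _ hxy]
    have h := RatFunc.intDegree_add_le hy hxy
    rcases le_max_iff.mp h with h | h
    · exact (zpow_le_zpow_right₀ (by norm_num) h).trans (le_max_left _ _)
    · exact (zpow_le_zpow_right₀ (by norm_num) h).trans (le_max_right _ _)
  refine ⟨{ toFun := g
            map_mul' := ?_
            nonneg' := hnn
            eq_zero' := ?_
            add_le' := fun _ _ => hna.add_le hnn }, hna, hg⟩
  · intro x y
    by_cases hx : x = 0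
    · simp [hx, hg0]
    by_cases hy : y = 0
    · simp [hy, hg0]
    rw [hg _ hx, hg _ hy, hg _ (mul_ne_zero hx hy), RatFunc.intDegree_mul hx hy,
      zpow_add₀ (by norm_num)]
  · intro x
    refine ⟨fun h => ?_, fun h => by rw [h, hg0]⟩
    by_contra hx
    rw [hg _ hx] at h
    exact zpow_ne_zero _ (by norm_num) h

theorem isAlgebraic_of_range_le {A F K : Type*} [CommRing A] [Field F] [Field K] [Algebra A K]
    [Algebra.IsAlgebraic A K] (φ : F →+* K) (hinj : Function.Injective (algebraMap A K))
    (h : ∀ a, algebraMap A K a ∈ φ.range) :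
    @Algebra.IsAlgebraic F K _ _ φ.toAlgebra := by
  let := φ.toAlgebra
  let e : F ≃+* φ.range := RingEquiv.ofBijective φ.rangeRestrict
    ⟨fun a b h => φ.injective (congrArg Subtype.val h), φ.rangeRestrict_surjective⟩
  let g : A →+* F := e.symm.toRingHom.comp ((algebraMap A K).codRestrict φ.range h)
  let := g.toAlgebra
  have hg : ∀ a, algebraMap A K a = φ (g a) := by
    intro a
    have : φ (g a) = (e (g a) : K) := rfl
    rw [this]
    simp [g]
  have : IsScalarTower A F K := IsScalarTower.of_algebraMap_eq hg
  refine Algebra.IsAlgebraic.extendScalars (R := A) (S := F) ?_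
  intro a b hab
  apply hinj
  rw [hg, hg]
  exact congrArg φ hab

theorem transcendental_setup {k K : Type*} [Field k] [Field K] [Algebra k K] (x : K)
    (hx : Transcendental k x) : ∃ E : IntermediateField k K, ∃ φ : RatFunc E →+* K,
      φ RatFunc.X = x ∧ @Algebra.IsAlgebraic (RatFunc E) K _ _ φ.toAlgebra := by
  obtain ⟨s, hs, hb⟩ := exists_isTranscendenceBasis_superset (R := k) (s := {x})
    (by simpa [AlgebraicIndepOn] using hx)
  let E := IntermediateField.adjoin k (s \ {x})
  have hxE : Transcendental E x := by
    have := hb.1.transcendental_adjoin (s := {i : s | (i : K) ≠ x}) (i := ⟨x, hs rfl⟩) (by simp)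
    have he : (Set.image Subtype.val {i : s | (i : K) ≠ x}) = s \ {x} := by
      ext z; simp [and_comm]
    rw [he] at this
    exact IntermediateField.transcendental_adjoin_iff.mpr this
  have hinj : Function.Injective (Polynomial.aeval (R := E) x).toRingHom :=
    transcendental_iff_injective.mp hxE
  let φ : RatFunc E →+* K := IsFractionRing.lift hinj
  have hφX : φ RatFunc.X = x := by
    rw [← RatFunc.algebraMap_X]
    simp only [φ, IsFractionRing.lift_algebraMap]
    simp
  have hφC : ∀ e : E, φ (RatFunc.C e) = e := by
    intro e
    rw [← RatFunc.algebraMap_C]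
    simp only [φ, IsFractionRing.lift_algebraMap]
    simp
  refine ⟨E, φ, hφX, ?_⟩
  let := φ.toAlgebra
  have hsub : ∀ a ∈ Algebra.adjoin k s, a ∈ φ.range := by
    intro a ha
    induction ha using Algebra.adjoin_induction with
    | mem z hz =>
      by_cases hzx : z = x
      · exact ⟨_, hφX.trans hzx.symm⟩
      · exact ⟨_, hφC ⟨z, IntermediateField.subset_adjoin _ _ ⟨hz, hzx⟩⟩⟩
    | algebraMap r => exact ⟨_, hφC (algebraMap k E r)⟩
    | add a b _ _ h1 h2 => exact add_mem h1 h2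
    | mul a b _ _ h1 h2 => exact mul_mem h1 h2
  have halg : Algebra.IsAlgebraic (Algebra.adjoin k s) K := by
    have := hb.isAlgebraic
    rwa [Subtype.range_coe] at this
  exact isAlgebraic_of_range_le (A := Algebra.adjoin k s) φ Subtype.val_injective
    (fun a => hsub a a.2)

theorem transcendental_abs {k K : Type*} [Field k] [Field K] [Algebra k K] (x : K)
    (hx : Transcendental k x) : ∃ v : AbsoluteValue K ℝ, 1 < v x ∧ ∀ y z : K, y ≠ 0 → z ≠ 0 →
      ∃ a b : ℤ, (a ≠ 0 ∨ b ≠ 0) ∧ a * Real.log (v y) + b * Real.log (v z) = 0 := by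
  obtain ⟨E, φ, hφ, halg⟩ := transcendental_setup x hx
  let := φ.toAlgebra
  obtain ⟨w, hw, hval⟩ := ratFunc_abs E
  have hX : w RatFunc.X = 2 := by
    rw [hval _ RatFunc.X_ne_zero, RatFunc.intDegree_X]; norm_num
  obtain ⟨v, hv, hext⟩ := exists_abs_extension (K := K) w hw RatFunc.X (by rw [hX]; norm_num)
  refine ⟨v, ?_, fun y z hy hz => ?_⟩
  · have : v x = w RatFunc.X := by rw [← hext]; exact congrArg v hφ.symm
    rw [this, hX]; norm_num
  · refine nonarch_rational_relation (A := RatFunc E) v hv (Real.log 2) (fun a ha => ?_) y z hy hz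
      (Algebra.IsAlgebraic.isAlgebraic y) (Algebra.IsAlgebraic.isAlgebraic z)
    exact ⟨a.intDegree, by rw [hext, hval a ha, Real.log_zpow]⟩


theorem le_of_pow_le_linear (X Y : ℝ) (hY : 0 ≤ Y) (h : ∀ n : ℕ, X ^ n ≤ (n + 1) * Y ^ n) :
    X ≤ Y := by
  by_contra! hlt
  have hX : 0 < X := hY.trans_lt hlt
  set r := Y / X with hr
  have hr0 : 0 ≤ r := by positivity
  have hr1 : r < 1 := (div_lt_one hX).mpr hlt
  have h1 := tendsto_pow_const_mul_const_pow_of_abs_lt_one 1 (r := r) (by rwa [abs_of_nonneg hr0])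
  have h2 := tendsto_pow_atTop_nhds_zero_of_lt_one hr0 hr1
  have h3 := h1.add h2
  rw [add_zero] at h3
  have h4 : (1 : ℝ) ≤ 0 := by
    refine ge_of_tendsto' h3 fun n => ?_
    have := h n
    rw [hr, div_pow]
    field_simp
    linarith
  linarith

theorem arch_triangle {K : Type*} [Field K] (v : AbsoluteValue K ℝ) (c : ℝ) (hc : 0 < c)
    (hn : ∀ n : ℕ, v (n : K) ^ c = n) (a b : K) : v (a + b) ^ c ≤ v a ^ c + v b ^ c := by
  set s := c⁻¹ with hs
  have hs0 : 0 < s := by positivity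
  have hinv : ∀ t : ℝ, 0 ≤ t → (t ^ c) ^ s = t := fun t ht => by
    rw [← Real.rpow_mul ht, hs, mul_inv_cancel₀ hc.ne', Real.rpow_one]
  have hinv' : ∀ t : ℝ, 0 ≤ t → (t ^ s) ^ c = t := fun t ht => by
    rw [← Real.rpow_mul ht, hs, inv_mul_cancel₀ hc.ne', Real.rpow_one]
  set A := v a ^ c with hA
  set B := v b ^ c with hB
  have hA0 : 0 ≤ A := Real.rpow_nonneg (v.nonneg _) _
  have hB0 : 0 ≤ B := Real.rpow_nonneg (v.nonneg _) _
  have key : v (a + b) ≤ (A + B) ^ s := by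
    refine le_of_pow_le_linear _ _ (by positivity) fun n => ?_
    rw [← map_pow, add_pow]
    refine (v.sum_le _ _).trans ?_
    have : ∀ i ∈ Finset.range (n + 1),
        v (a ^ i * b ^ (n - i) * (n.choose i : K)) ≤ ((A + B) ^ s) ^ n := by
      intro i hi
      rw [← Real.rpow_natCast, ← Real.rpow_mul (by positivity), mul_comm s, Real.rpow_mul (by positivity),
        Real.rpow_natCast]
      rw [← hinv (v _) (v.nonneg _)]
      refine Real.rpow_le_rpow (Real.rpow_nonneg (v.nonneg _) _) ?_ hs0.le
      rw [map_mul, map_mul, map_pow, map_pow, Real.mul_rpow (by positivity) (by positivity),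
        Real.mul_rpow (by positivity) (by positivity), hn, ← Real.rpow_pow_comm (by positivity),
        ← Real.rpow_pow_comm (by positivity), add_pow]
      exact Finset.single_le_sum (f := fun i => A ^ i * B ^ (n - i) * (n.choose i : ℝ))
        (fun j _ => by positivity) hi
    refine (Finset.sum_le_sum this).trans ?_
    simp
  calc v (a + b) ^ c ≤ ((A + B) ^ s) ^ c := Real.rpow_le_rpow (v.nonneg _) key hc.le
    _ = A + B := hinv' _ (by positivity)

theorem complex_embedding_of_norm {E : Type*} [NormedField E] [CompleteSpace E] [CharZero E]
    (h : ∀ a : ℚ, ‖(a : E)‖ = |(a : ℝ)|) : Nonempty (E →+* ℂ) := by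
  let f : ℚ →+* E := Rat.castHom E
  have hiso : Isometry f := by
    refine AddMonoidHomClass.isometry_of_norm f fun a => ?_
    change ‖(a : E)‖ = ‖a‖
    rw [h]; rfl
  let i : ℚ →+* ℝ := Rat.castHom ℝ
  have ui : IsUniformInducing i := Rat.isUniformEmbedding_coe_real.isUniformInducing
  have di : DenseRange i := Rat.denseRange_cast
  let F : ℝ →+* E := IsDenseInducing.extendRingHom ui di hiso.uniformContinuous
  have hFc : Continuous F :=
    (uniformContinuous_uniformly_extend ui di hiso.uniformContinuous).continuous
  have hFi : ∀ a : ℚ, F a = a := fun a =>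
    (ui.isDenseInducing di).extend_eq (f := f) hiso.continuous a
  have hFn : ∀ r : ℝ, ‖F r‖ = ‖r‖ := by
    intro r
    refine congrFun (di.equalizer (g := fun r => ‖F r‖) (h := fun r => ‖r‖) hFc.norm continuous_norm ?_) r
    ext a
    change ‖F (a : ℝ)‖ = ‖(a : ℝ)‖
    rw [hFi, h]; rfl
  let : Algebra ℝ E := F.toAlgebra
  let : NormedAlgebra ℝ E :=
    { norm_smul_le := fun r x => by
        rw [Algebra.smul_def, norm_mul]
        change ‖F r‖ * _ ≤ _
        rw [hFn] }
  rcases NormedAlgebra.Real.nonempty_algEquiv_or E with ⟨⟨e⟩⟩ | ⟨⟨e⟩⟩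
  · exact ⟨Complex.ofRealHom.comp (e : E →+* ℝ)⟩
  · exact ⟨(e : E →+* ℂ)⟩

theorem complex_embedding_of_arch {K : Type*} [Field K] [CharZero K] (v : AbsoluteValue K ℝ)
    (h : ¬ ∀ n : ℕ, v (n : K) ≤ 1) : Nonempty (K →+* ℂ) := by
  let w : AbsoluteValue ℚ ℝ := v.comp (algebraMap ℚ K).injective
  have hw : ∀ a : ℚ, w a = v (a : K) := fun _ => rfl
  have hub : ¬ ∀ n : ℕ, w n ≤ 1 := by
    intro hh
    apply h
    intro n
    have := hh n
    rwa [hw, Rat.cast_natCast] at this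
  have he := Rat.AbsoluteValue.equiv_real_of_unbounded hub
  rw [AbsoluteValue.isEquiv_iff_exists_rpow_eq] at he
  obtain ⟨c, hc, he⟩ := he
  have hq : ∀ a : ℚ, v (a : K) ^ c = |(a : ℝ)| := by
    intro a
    have := congrFun he a
    simpa [hw] using this
  let v' : AbsoluteValue K ℝ :=
    { toFun := fun a => v a ^ c
      map_mul' := fun a b => by
        rw [map_mul, Real.mul_rpow (v.nonneg _) (v.nonneg _)]
      nonneg' := fun a => Real.rpow_nonneg (v.nonneg _) _
      eq_zero' := fun a => by
        rw [Real.rpow_eq_zero (v.nonneg _) hc.ne', v.eq_zero]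
      add_le' := fun a b => by
        refine arch_triangle v c hc (fun n => ?_) a b
        have := hq n
        simpa using this }
  let E := v'.Completion
  let ι : K →+* E := (UniformSpace.Completion.coeRingHom : WithAbs v' →+* E).comp
    (WithAbs.equiv v').symm.toRingHom
  have hι : ∀ a : K, ‖ι a‖ = v a ^ c := fun a => UniformSpace.Completion.norm_coe _
  have : CharZero E := charZero_of_injective_ringHom ι.injective
  obtain ⟨j⟩ := complex_embedding_of_norm (E := E) (fun a => by
    rw [← map_ratCast ι a, hι, hq])
  exact ⟨j.comp ι⟩


theorem extend_embedding {K : Type*} {F : Type*} [Field K] [Field F] [Countable F] [Algebra F K]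
    {Ω : Type} [Field Ω] [IsAlgClosed Ω] (hΩ : Nonempty (ℂ ≃ Ω)) (ι : K →+* ℂ)
    (σ : F →+* Ω) : ∃ τ : K →+* Ω, ∀ a : F, τ (algebraMap F K a) = σ a := by
  let : Algebra F ℂ := (ι.comp (algebraMap F K)).toAlgebra
  let : Algebra F Ω := σ.toAlgebra
  obtain ⟨s, hs⟩ := exists_isTranscendenceBasis F ℂ
  obtain ⟨t, ht⟩ := exists_isTranscendenceBasis F Ω
  have hC : Cardinal.aleph0 < Cardinal.mk ℂ := by
    rw [Cardinal.mk_complex]; exact Cardinal.aleph0_lt_continuum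
  have hO : Cardinal.aleph0 < Cardinal.mk Ω := by
    rwa [← Cardinal.mk_congr hΩ.some]
  have hF : Cardinal.mk F ≤ Cardinal.aleph0 := Cardinal.mk_le_aleph0
  have h1 := IsAlgClosed.cardinal_eq_cardinal_transcendence_basis_of_aleph0_lt _ hs hF hC
  have h2 := IsAlgClosed.cardinal_eq_cardinal_transcendence_basis_of_aleph0_lt _ ht hF hO
  have h3 : Cardinal.mk s = Cardinal.mk t := by
    rw [Cardinal.lift_id, Cardinal.lift_id] at h1 h2
    rw [← h1, ← h2]
    exact Cardinal.mk_congr hΩ.some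
  obtain ⟨e⟩ := Cardinal.eq.1 h3
  let := IsAlgClosed.isAlgClosure_of_transcendence_basis _ hs
  let := IsAlgClosed.isAlgClosure_of_transcendence_basis _ ht
  let e' : Algebra.adjoin F (Set.range ((↑) : s → ℂ)) ≃ₐ[F]
      Algebra.adjoin F (Set.range ((↑) : t → Ω)) :=
    (hs.1.aevalEquiv.symm.trans (MvPolynomial.renameEquiv F e)).trans ht.1.aevalEquiv
  let E : ℂ ≃+* Ω := IsAlgClosure.equivOfEquiv ℂ Ω e'.toRingEquiv
  refine ⟨(E : ℂ →+* Ω).comp ι, fun a => ?_⟩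
  have h4 := IsAlgClosure.equivOfEquiv_algebraMap ℂ Ω e'.toRingEquiv
    (algebraMap F (Algebra.adjoin F (Set.range ((↑) : s → ℂ))) a)
  have h5 : e'.toRingEquiv (algebraMap F (Algebra.adjoin F (Set.range ((↑) : s → ℂ))) a) =
      algebraMap F (Algebra.adjoin F (Set.range ((↑) : t → Ω))) a := e'.commutes a
  rw [h5] at h4
  exact h4

theorem padicAlgCl_equiv (p : ℕ) [Fact p.Prime] : Nonempty (ℂ ≃ PadicAlgCl p) := by
  rw [← Cardinal.eq, Cardinal.mk_complex]
  apply le_antisymm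
  · refine (continuum_le_cardinal_of_nontriviallyNormedField ℚ_[p]).trans ?_
    exact Cardinal.mk_le_of_injective (algebraMap ℚ_[p] (PadicAlgCl p)).injective
  · have h1 := Algebra.IsAlgebraic.cardinalMk_le_max ℚ_[p] (PadicAlgCl p)
    refine h1.trans (max_le ?_ Cardinal.aleph0_le_continuum)
    have h2 : Cardinal.mk ℚ_[p] ≤ Cardinal.mk (PadicSeq p) := Cardinal.mk_quotient_le
    have h3 : Cardinal.mk (PadicSeq p) ≤ Cardinal.mk (ℕ → ℚ) := Cardinal.mk_subtype_le _
    have h4 : Cardinal.mk (ℕ → ℚ) = Cardinal.continuum := by simp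
    exact h2.trans (h3.trans h4.le)

theorem integral_of_padic {F : Type*} [Field F] [NumberField F] (x : F)
    (h : ∀ (p : ℕ) [Fact p.Prime] (σ : F →+* PadicAlgCl p), ‖σ x‖ ≤ 1) : IsIntegral ℤ x := by
  have hx : IsIntegral ℚ x := Algebra.IsIntegral.isIntegral x
  have key : ∀ n, ((minpoly ℚ x).coeff n).den = 1 := by
    intro n
    by_contra hne
    obtain ⟨p, hp, hpd⟩ := Nat.exists_prime_and_dvd hne
    have : Fact p.Prime := ⟨hp⟩
    let O : Subring (PadicAlgCl p) := (Valued.v : Valuation (PadicAlgCl p) NNReal).integer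
    have hO : ∀ z, z ∈ O ↔ ‖z‖ ≤ 1 := fun z => Iff.rfl
    have hsp : ((minpoly ℚ x).map (algebraMap ℚ (PadicAlgCl p))).Splits :=
      IsAlgClosed.splits _
    have hmon : ((minpoly ℚ x).map (algebraMap ℚ (PadicAlgCl p))).Monic :=
      (minpoly.monic hx).map _
    have hmem : (minpoly ℚ x).map (algebraMap ℚ (PadicAlgCl p)) ∈
        Polynomial.lifts O.subtype := by
      rw [hsp.eq_prod_roots_of_monic hmon]
      refine Subsemiring.multiset_prod_mem _ _ fun q hq => ?_
      rw [Multiset.mem_map] at hq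
      obtain ⟨r, hr, rfl⟩ := hq
      have hr' : r ∈ (minpoly ℚ x).rootSet (PadicAlgCl p) := by
        rw [Polynomial.mem_rootSet']
        rw [Polynomial.mem_roots'] at hr
        refine ⟨hr.1, ?_⟩
        rw [Polynomial.aeval_def, ← Polynomial.eval_map]
        exact hr.2
      rw [← NumberField.Embeddings.range_eval_eq_rootSet_minpoly F] at hr'
      obtain ⟨σ, rfl⟩ := hr'
      have h1 : σ x ∈ O := (hO _).2 (h p σ)
      refine ⟨Polynomial.X - Polynomial.C ⟨σ x, h1⟩, ?_⟩
      simp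
    rw [Polynomial.lifts_iff_coeff_lifts] at hmem
    obtain ⟨⟨c, hc⟩, hcc⟩ := hmem n
    rw [Polynomial.coeff_map] at hcc
    have hc' : ‖algebraMap ℚ (PadicAlgCl p) ((minpoly ℚ x).coeff n)‖ ≤ 1 := by
      rw [← hcc]; exact hc
    rw [IsScalarTower.algebraMap_apply ℚ ℚ_[p] (PadicAlgCl p), PadicAlgCl.norm_extends] at hc'
    have hu := PadicInt.isUnit_den _ hc'
    exact absurd hpd (by simpa [Nat.Prime.coprime_iff_not_dvd hp] using PadicInt.isUnit_iff.1 hu)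
  have hl : minpoly ℚ x ∈ Polynomial.lifts (algebraMap ℤ ℚ) := by
    rw [Polynomial.lifts_iff_coeff_lifts]
    intro n
    exact ⟨((minpoly ℚ x).coeff n).num, Rat.coe_int_num_of_den_eq_one (key n)⟩
  obtain ⟨q, hq, -, hqm⟩ := Polynomial.lifts_and_natDegree_eq_and_monic hl (minpoly.monic hx)
  refine ⟨q, hqm, ?_⟩
  have := minpoly.aeval ℚ x
  rw [← hq, Polynomial.aeval_map_algebraMap] at this
  exact this


theorem lox_log_monoAct {K : Type*} [Field K] (v : AbsoluteValue K ℝ)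
    (A : Matrix (Fin 2) (Fin 2) ℤ) (g : Kˣ × Kˣ) :
    Real.log (v ((monoAct A g).1 : K)) =
        A 0 0 * Real.log (v (g.1 : K)) + A 0 1 * Real.log (v (g.2 : K)) ∧
      Real.log (v ((monoAct A g).2 : K)) =
        A 1 0 * Real.log (v (g.1 : K)) + A 1 1 * Real.log (v (g.2 : K)) := by
  have h1 : v (g.1 : K) ≠ 0 := v.ne_zero g.1.ne_zero
  have h2 : v (g.2 : K) ≠ 0 := v.ne_zero g.2.ne_zero
  constructor <;>
  · simp only [monoAct, Units.val_mul, Units.val_zpow_eq_zpow_val, map_mul, map_zpow₀]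
    rw [Real.log_mul (zpow_ne_zero _ h1) (zpow_ne_zero _ h2), Real.log_zpow, Real.log_zpow]

theorem lox_abs_eq_one {K : Type*} [Field K] (v : AbsoluteValue K ℝ) (x : Kˣ)
    (h : Real.log (v (x : K)) = 0) : v (x : K) = 1 :=
  Real.eq_one_of_pos_of_log_eq_zero (v.pos x.ne_zero) h

/-- The logarithmic orbit of `g` under the powers of `M` is bounded for each absolute value. -/
def LogBounded {K : Type*} [Field K] (M : Matrix (Fin 2) (Fin 2) ℤ) (g : Kˣ × Kˣ) : Prop :=
  ∀ v : AbsoluteValue K ℝ, ∃ C : ℝ, ∀ n : ℕ,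
    |Real.log (v ((monoAct (M ^ n) g).1 : K))| ≤ C ∧
      |Real.log (v ((monoAct (M ^ n) g).2 : K))| ≤ C

theorem lox_rel_trivial {K : Type*} [Field K] (M : Matrix (Fin 2) (Fin 2) ℤ)
    (hdet : M.det = 1 ∨ M.det = -1) (htr : 2 < |M.trace|) (g : Kˣ × Kˣ) (hB : LogBounded M g)
    (v : AbsoluteValue K ℝ)
    (hrel : ∃ a b : ℤ, (a ≠ 0 ∨ b ≠ 0) ∧
      a * Real.log (v (g.1 : K)) + b * Real.log (v (g.2 : K)) = 0) :
    v (g.1 : K) = 1 ∧ v (g.2 : K) = 1 := by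
  obtain ⟨a, b, hab, hrel⟩ := hrel
  obtain ⟨C, hC⟩ := hB v
  have h := lox_rational_bounded M hdet htr _ _ a b hab hrel ⟨C, fun n => by
    have := hC n
    rwa [(lox_log_monoAct v _ g).1, (lox_log_monoAct v _ g).2] at this⟩
  exact ⟨lox_abs_eq_one v _ h.1, lox_abs_eq_one v _ h.2⟩

theorem lox_algebraic {k K : Type*} [Field k] [Field K] [Algebra k K]
    (M : Matrix (Fin 2) (Fin 2) ℤ)
    (hdet : M.det = 1 ∨ M.det = -1) (htr : 2 < |M.trace|) (g : Kˣ × Kˣ) (hB : LogBounded M g) :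
    IsAlgebraic k (g.1 : K) ∧ IsAlgebraic k (g.2 : K) := by
  constructor
  · by_contra h
    obtain ⟨v, hv, hr⟩ := transcendental_abs (k := k) _ h
    have := (lox_rel_trivial M hdet htr g hB v (hr _ _ g.1.ne_zero g.2.ne_zero)).1
    linarith
  · by_contra h
    obtain ⟨v, hv, hr⟩ := transcendental_abs (k := k) _ h
    have := (lox_rel_trivial M hdet htr g hB v (hr _ _ g.1.ne_zero g.2.ne_zero)).2
    linarith

theorem lox_nonarch {K : Type*} [Field K] [CharZero K] (M : Matrix (Fin 2) (Fin 2) ℤ)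
    (hdet : M.det = 1 ∨ M.det = -1) (htr : 2 < |M.trace|) (g : Kˣ × Kˣ) (hB : LogBounded M g)
    (v : AbsoluteValue K ℝ) (hv : IsNonarchimedean v) :
    v (g.1 : K) = 1 ∧ v (g.2 : K) = 1 := by
  have ha := lox_algebraic (k := ℚ) M hdet htr g hB
  obtain ⟨τ, hτ⟩ := nonarch_rat_values v hv
  exact lox_rel_trivial M hdet htr g hB v
    (nonarch_rational_relation v hv τ hτ _ _ g.1.ne_zero g.2.ne_zero ha.1 ha.2)

theorem lox_monoAct_one_of {K : Type*} [Field K] (v : AbsoluteValue K ℝ)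
    (A : Matrix (Fin 2) (Fin 2) ℤ) (g : Kˣ × Kˣ) (h : v (g.1 : K) = 1 ∧ v (g.2 : K) = 1) :
    v ((monoAct A g).1 : K) = 1 ∧ v ((monoAct A g).2 : K) = 1 := by
  have := lox_log_monoAct v A g
  rw [h.1, h.2] at this
  simp only [Real.log_one, mul_zero, add_zero] at this
  exact ⟨lox_abs_eq_one v _ this.1, lox_abs_eq_one v _ this.2⟩

theorem lox_arch {K : Type*} [Field K] [CharZero K] (M : Matrix (Fin 2) (Fin 2) ℤ)
    (hdet : M.det = 1 ∨ M.det = -1) (htr : 2 < |M.trace|) (g : Kˣ × Kˣ) (hB : LogBounded M g)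
    (ι : K →+* ℂ) : ∃ d : ℤ, d ≠ 0 ∧ g.1 ^ d = 1 ∧ g.2 ^ d = 1 := by
  have ha := lox_algebraic (k := ℚ) M hdet htr g hB
  let F : IntermediateField ℚ K := IntermediateField.adjoin ℚ {(g.1 : K), (g.2 : K)}
  have hfin : FiniteDimensional ℚ F := by
    apply IntermediateField.finiteDimensional_adjoin
    intro z hz
    rcases hz with rfl | rfl
    · exact ha.1.isIntegral
    · exact ha.2.isIntegral
  have hnf : NumberField F := { to_charZero := inferInstance, to_finiteDimensional := hfin }
  have hcount : Countable F := by
    have h1 := Algebra.IsAlgebraic.lift_cardinalMk_le_max ℚ F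
    rw [← Cardinal.mk_le_aleph0_iff]
    simpa using h1
  have hm1 : (g.1 : K) ∈ F := IntermediateField.subset_adjoin _ _ (by simp)
  have hm2 : (g.2 : K) ∈ F := IntermediateField.subset_adjoin _ _ (by simp)
  let gF : Fˣ × Fˣ := (Units.mk0 ⟨(g.1 : K), hm1⟩ (by simp [Subtype.ext_iff]),
    Units.mk0 ⟨(g.2 : K), hm2⟩ (by simp [Subtype.ext_iff]))
  let φ : Fˣ →* Kˣ := Units.map (algebraMap F K : F →+* K)
  have hg : g = (φ gF.1, φ gF.2) := by
    ext <;> rfl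
  have hz : ∀ n, monoAct (M ^ n) g = (φ (monoAct (M ^ n) gF).1, φ (monoAct (M ^ n) gF).2) := by
    intro n
    rw [← monoAct_map, ← hg]
  have hz1 : ∀ n, ((monoAct (M ^ n) g).1 : K) = algebraMap F K ((monoAct (M ^ n) gF).1 : F) := by
    intro n; rw [hz]; rfl
  have hz2 : ∀ n, ((monoAct (M ^ n) g).2 : K) = algebraMap F K ((monoAct (M ^ n) gF).2 : F) := by
    intro n; rw [hz]; rfl
  have hpad : ∀ (p : ℕ) [Fact p.Prime] (σ : F →+* PadicAlgCl p) (n : ℕ),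
      ‖σ ((monoAct (M ^ n) gF).1 : F)‖ = 1 ∧ ‖σ ((monoAct (M ^ n) gF).2 : F)‖ = 1 := by
    intro p _ σ n
    obtain ⟨τ, hτ⟩ := extend_embedding (padicAlgCl_equiv p) ι σ
    let v : AbsoluteValue K ℝ := (NormedField.toAbsoluteValue (PadicAlgCl p)).comp τ.injective
    have hv : ∀ a, v a = ‖τ a‖ := fun _ => rfl
    have hna : IsNonarchimedean v := by
      intro a b
      rw [hv, hv, hv, map_add]
      exact PadicAlgCl.isNonarchimedean p _ _
    have := lox_monoAct_one_of v (M ^ n) g (lox_nonarch M hdet htr g hB v hna)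
    rwa [hz1, hz2, hv, hv, hτ, hτ] at this
  have hzint1 : ∀ n, IsIntegral ℤ ((monoAct (M ^ n) gF).1 : F) := fun n =>
    integral_of_padic _ fun p _ σ => (hpad p σ n).1.le
  have hzint2 : ∀ n, IsIntegral ℤ ((monoAct (M ^ n) gF).2 : F) := fun n =>
    integral_of_padic _ fun p _ σ => (hpad p σ n).2.le
  have hbd : ∀ σ : F →+* ℂ, ∃ B : ℝ, ∀ n, ‖σ ((monoAct (M ^ n) gF).1 : F)‖ ≤ B ∧
      ‖σ ((monoAct (M ^ n) gF).2 : F)‖ ≤ B := by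
    intro σ
    obtain ⟨τ, hτ⟩ := extend_embedding ⟨Equiv.refl ℂ⟩ ι σ
    let v : AbsoluteValue K ℝ := (NormedField.toAbsoluteValue ℂ).comp τ.injective
    have hv : ∀ a, v a = ‖τ a‖ := fun _ => rfl
    obtain ⟨C, hC⟩ := hB v
    refine ⟨Real.exp C, fun n => ?_⟩
    have h := hC n
    have h1 := v.pos (monoAct (M ^ n) g).1.ne_zero
    have h2 := v.pos (monoAct (M ^ n) g).2.ne_zero
    have h3 := (Real.log_le_iff_le_exp h1).1 ((le_abs_self _).trans h.1)
    have h4 := (Real.log_le_iff_le_exp h2).1 ((le_abs_self _).trans h.2)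
    rw [hz1, hv, hτ] at h3
    rw [hz2, hv, hτ] at h4
    exact ⟨h3, h4⟩
  choose B hBB using hbd
  obtain ⟨R, hR⟩ := (Set.finite_range B).bddAbove
  have hR' : ∀ σ, B σ ≤ R := fun σ => hR ⟨σ, rfl⟩
  have hS := NumberField.Embeddings.finite_of_norm_le F ℂ R
  have hninj : ¬ Function.Injective (fun n : ℕ => monoAct (M ^ n) gF) := by
    intro hinj
    have hinj2 : Function.Injective (fun n : ℕ =>
        (((monoAct (M ^ n) gF).1 : F), ((monoAct (M ^ n) gF).2 : F))) := by
      intro a b hab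
      apply hinj
      simp only [Prod.mk.injEq, Units.val_inj] at hab
      exact Prod.ext hab.1 hab.2
    refine Set.infinite_of_injective_forall_mem hinj2 (fun n => ?_) (hS.prod hS)
    exact ⟨⟨hzint1 n, fun σ => (hBB σ n).1.trans (hR' σ)⟩,
      ⟨hzint2 n, fun σ => (hBB σ n).2.trans (hR' σ)⟩⟩
  have hex : ∃ m n : ℕ, m < n ∧ monoAct (M ^ m) g = monoAct (M ^ n) g := by
    simp only [Function.Injective, not_forall] at hninj
    obtain ⟨a, b, hab, hne⟩ := hninj
    rcases lt_or_gt_of_ne hne with h | h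
    · exact ⟨a, b, h, by rw [hz, hz, hab]⟩
    · exact ⟨b, a, h, by rw [hz, hz, hab]⟩
  obtain ⟨m, n, hmn, h⟩ := hex
  exact lox_torsion M hdet htr g m n hmn h

theorem lox_main {K : Type*} [Field K] (M : Matrix (Fin 2) (Fin 2) ℤ)
    (hdet : M.det = 1 ∨ M.det = -1) (htr : 2 < |M.trace|) (g : Kˣ × Kˣ) (hB : LogBounded M g)
    (v : AbsoluteValue K ℝ) : v (g.1 : K) = 1 ∧ v (g.2 : K) = 1 := by
  obtain ⟨p, hp⟩ := CharP.exists K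
  rcases CharP.char_is_prime_or_zero K p with h | h
  · have : Fact p.Prime := ⟨h⟩
    let := ZMod.algebra K p
    have ha := lox_algebraic (k := ZMod p) M hdet htr g hB
    exact ⟨charP_algebraic_value p v _ g.1.ne_zero ha.1,
      charP_algebraic_value p v _ g.2.ne_zero ha.2⟩
  · subst h
    have := CharP.charP_to_charZero K
    by_cases hn : ∀ n : ℕ, v (n : K) ≤ 1
    · exact lox_nonarch M hdet htr g hB v (nonarch_of_nat_le_one v hn)
    · obtain ⟨ι⟩ := complex_embedding_of_arch v hn
      obtain ⟨d, hd, h1, h2⟩ := lox_arch M hdet htr g hB ι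
      have key : ∀ x : Kˣ, x ^ d = 1 → v (x : K) = 1 := by
        intro x hx
        apply lox_abs_eq_one
        have := congrArg (fun u : Kˣ => Real.log (v (u : K))) hx
        simp only [Units.val_zpow_eq_zpow_val, map_zpow₀, Real.log_zpow, Units.val_one, map_one,
          Real.log_one] at this
        exact (mul_eq_zero.1 this).resolve_left (by exact_mod_cast hd)
      exact ⟨key _ h1, key _ h2⟩

theorem lox_fixed {K : Type u} [Field K] (M : Matrix (Fin 2) (Fin 2) ℤ)
    (hD : (1 - M).det ≠ 0) (α β : Kˣ) :
    ∃ (L : Type u) (_ : Field L) (_ : Algebra K L), FiniteDimensional K L ∧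
      ∃ q : Lˣ × Lˣ,
        (Units.map ((algebraMap K L : K →+* L) : K →* L) α *
            (q.1 ^ M 0 0 * q.2 ^ M 0 1),
         Units.map ((algebraMap K L : K →+* L) : K →* L) β *
            (q.1 ^ M 1 0 * q.2 ^ M 1 1)) = q := by
  set D := (1 - M).det with hDdef
  let Ω := AlgebraicClosure K
  let φ : Kˣ →* Ωˣ := Units.map ((algebraMap K Ω : K →+* Ω) : K →* Ω)
  have hroot : ∀ a : Ωˣ, ∃ r : Ωˣ, r ^ D = a := by
    have hn : ∀ a : Ωˣ, ∃ r : Ωˣ, r ^ D.natAbs = a := by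
      intro a
      obtain ⟨z, hz⟩ := IsAlgClosed.exists_pow_nat_eq (a : Ω) (n := D.natAbs)
        (Int.natAbs_pos.2 hD)
      have hz0 : z ≠ 0 := by
        rintro rfl
        rw [zero_pow (Int.natAbs_ne_zero.2 hD)] at hz
        exact a.ne_zero hz.symm
      exact ⟨Units.mk0 z hz0, Units.ext (by simpa using hz)⟩
    intro a
    rcases Int.natAbs_eq D with h | h
    · obtain ⟨r, hr⟩ := hn a
      exact ⟨r, by rw [h, zpow_natCast, hr]⟩
    · obtain ⟨r, hr⟩ := hn a⁻¹
      exact ⟨r, by rw [h, zpow_neg, zpow_natCast, hr, inv_inv]⟩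
  obtain ⟨r, hr⟩ := hroot (φ α)
  obtain ⟨s, hs⟩ := hroot (φ β)
  let q := monoAct (1 - M).adjugate (r, s)
  have hq : monoAct (1 - M) q = (φ α, φ β) := by
    rw [← monoAct_mul, Matrix.mul_adjugate, monoAct_scalar, ← hDdef, hr, hs]
  let L : IntermediateField K Ω := IntermediateField.adjoin K {(q.1 : Ω), (q.2 : Ω)}
  have hm1 : (q.1 : Ω) ∈ L := IntermediateField.subset_adjoin _ _ (by simp)
  have hm2 : (q.2 : Ω) ∈ L := IntermediateField.subset_adjoin _ _ (by simp)
  have hfin : FiniteDimensional K L := by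
    apply IntermediateField.finiteDimensional_adjoin
    intro z hz
    exact Algebra.IsIntegral.isIntegral z
  let qL : Lˣ × Lˣ := (Units.mk0 ⟨(q.1 : Ω), hm1⟩ (by simp [Subtype.ext_iff]),
    Units.mk0 ⟨(q.2 : Ω), hm2⟩ (by simp [Subtype.ext_iff]))
  let ψ : Lˣ →* Ωˣ := Units.map (algebraMap L Ω : L →+* Ω)
  have hψ : Function.Injective ψ := Units.map_injective (algebraMap L Ω).injective
  have hψ1 : ψ qL.1 = q.1 := Units.ext rfl
  have hψ2 : ψ qL.2 = q.2 := Units.ext rfl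
  have hα : ∀ a : Kˣ, ψ (Units.map ((algebraMap K L : K →+* L) : K →* L) a) = φ a :=
    fun a => Units.ext rfl
  have e1 := congrArg Prod.fst hq
  have e2 := congrArg Prod.snd hq
  simp only [monoAct, Matrix.sub_apply, Matrix.one_apply_eq, zpow_sub, zpow_one] at e1 e2
  rw [Matrix.one_apply_ne (by decide), zpow_zero] at e1 e2
  refine ⟨L, inferInstance, inferInstance, hfin, qL, ?_⟩
  apply Prod.ext
  · apply hψ
    simp only [map_mul, map_zpow, hψ1, hψ2, hα]
    rw [← e1, one_mul, mul_assoc q.1, ← mul_inv, inv_mul_cancel_right]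
  · apply hψ
    simp only [map_mul, map_zpow, hψ1, hψ2, hα]
    rw [← e2, one_mul, mul_left_comm _ q.2, ← mul_inv, inv_mul_cancel_right]

theorem lox_log_diff {K : Type*} [Field K] (v : AbsoluteValue K ℝ) (a b : Kˣ) :
    Real.log (v ((a / b : Kˣ) : K)) = Real.log (v (a : K)) - Real.log (v (b : K)) := by
  rw [Units.val_div_eq_div_val, map_div₀, Real.log_div (v.ne_zero a.ne_zero) (v.ne_zero b.ne_zero)]

/-- For a pseudo-monomial automorphism `f = M + b` of `(Kˣ)²` with loxodromic monomial
part `M ∈ GL₂(ℤ)`: `Id - M` is invertible over `ℚ`; `f` acquires a fixed point after a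
finite field extension; and if for every absolute value `v` on `K` the logarithmic orbit
sequence of `p` is bounded, then `‖fⁿ(p)‖_v = ‖p‖_v` for all `n` and all `v`. -/
theorem loxodromic_pseudomonomial_fixed_and_bounded {K : Type u} [Field K]
    (M : Matrix (Fin 2) (Fin 2) ℤ) (hdet : M.det = 1 ∨ M.det = -1)
    (htr : 2 < |M.trace|) (α β : Kˣ) (f : Kˣ × Kˣ → Kˣ × Kˣ)
    (hf : ∀ p : Kˣ × Kˣ, f p = (α * (p.1 ^ M 0 0 * p.2 ^ M 0 1),
                                β * (p.1 ^ M 1 0 * p.2 ^ M 1 1)))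
    (p : Kˣ × Kˣ) :
    IsUnit (1 - M.map (Int.cast : ℤ → ℚ)) ∧
    (∃ (L : Type u) (_ : Field L) (_ : Algebra K L), FiniteDimensional K L ∧
      ∃ q : Lˣ × Lˣ,
        (Units.map ((algebraMap K L : K →+* L) : K →* L) α *
            (q.1 ^ M 0 0 * q.2 ^ M 0 1),
         Units.map ((algebraMap K L : K →+* L) : K →* L) β *
            (q.1 ^ M 1 0 * q.2 ^ M 1 1)) = q) ∧
    ((∀ v : AbsoluteValue K ℝ, ∃ C : ℝ, ∀ n : ℕ,
        |Real.log (v ((f^[n] p).1 : K))| ≤ C ∧ |Real.log (v ((f^[n] p).2 : K))| ≤ C) →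
      ∀ (v : AbsoluteValue K ℝ) (n : ℕ),
        max (v ((f^[n] p).1 : K)) (v ((f^[n] p).2 : K)) =
          max (v (p.1 : K)) (v (p.2 : K))) := by
  have hdet1 : (1 - M).det ≠ 0 := by
    have h := lox_det_pow_sub_one M hdet htr 1 one_pos
    rw [pow_one] at h
    intro h0
    apply h
    rw [← neg_sub, Matrix.det_neg, h0, mul_zero]
  refine ⟨?_, lox_fixed M hdet1 α β, ?_⟩
  · have h1 : (1 - M.map (Int.cast : ℤ → ℚ)) = (1 - M).map (Int.castRingHom ℚ) := by
      rw [Matrix.map_sub _ (map_sub _), Matrix.map_one _ (map_zero _) (map_one _)]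
      rfl
    rw [h1, Matrix.isUnit_iff_isUnit_det, ← RingHom.mapMatrix_apply, ← RingHom.map_det,
      isUnit_iff_ne_zero]
    simpa using hdet1
  · intro hbd v n
    let g : Kˣ × Kˣ := f p / p
    have hf' : ∀ q, f q = (α, β) * monoAct M q := fun q => hf q
    have hstep : ∀ m, f^[m + 1] p = monoAct (M ^ m) g * f^[m] p := by
      intro m
      induction m with
      | zero => simp [monoAct_one, g]
      | succ m ih =>
        rw [Function.iterate_succ_apply', hf', ih, monoAct_map_mul, ← monoAct_mul, ← pow_succ',
          mul_left_comm, ← hf', ← Function.iterate_succ_apply' f, ih]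
    have hB : LogBounded M g := by
      intro w
      obtain ⟨C, hC⟩ := hbd w
      refine ⟨C + C, fun m => ?_⟩
      have h0 := hC m
      have h1 := hC (m + 1)
      have hg : monoAct (M ^ m) g = f^[m + 1] p / f^[m] p := by
        rw [hstep]; simp
      rw [hg, Prod.fst_div, Prod.snd_div, lox_log_diff, lox_log_diff]
      exact ⟨(abs_sub _ _).trans (add_le_add h1.1 h0.1),
        (abs_sub _ _).trans (add_le_add h1.2 h0.2)⟩
    induction n with
    | zero => rfl
    | succ n ih =>
      have h := lox_monoAct_one_of v (M ^ n) g (lox_main M hdet htr g hB v)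
      rw [← ih, hstep, Prod.fst_mul, Prod.snd_mul, Units.val_mul, Units.val_mul, map_mul, map_mul,
        h.1, h.2, one_mul, one_mul]
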